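/- arXiv:2506.05152 — 3 statements merged into one kernel-verified Lean document; each statement's English description precedes it below -/
import Mathlib

section
/- Let N ≥ 2, a > 0, β ∈ ℝ \ {0}, let ε₀ ∈ (0, π/2) satisfy tan ε₀ ≥ |β|/√2, and let ε ∈ (ε₀, π/2). Then for every ξ' ∈ ℝ^{N−1}, every λ ∈ Σ_ε, and j ∈ {1, 2}, one has z_j(λ) + A² ≠ 0, where A = |ξ'| (equivalently, the characteristic roots satisfy L_j(λ, ξ')² ≠ 0). -/
noncomputable section

open Complex

/-- The sector `Σ_ε = {λ ∈ ℂ \ {0} : |arg λ| < π - ε}`. -/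
def SectorS (ε : ℝ) : Set ℂ := {lam : ℂ | lam ≠ 0 ∧ |lam.arg| < Real.pi - ε}

/-- The characteristic polynomial `P₂(ξ, λ)`. -/
def P2 {N : ℕ} (a β : ℝ) (ξ : EuclideanSpace ℝ (Fin N)) (lam : ℂ) : ℂ :=
  (lam + (‖ξ‖ : ℂ) ^ 2) * (lam + (‖ξ‖ : ℂ) ^ 2 + (a : ℂ)) +
    ((β : ℂ) ^ 2 / 2) * ((‖ξ‖ : ℂ) ^ 4 + (a : ℂ) * (‖ξ‖ : ℂ) ^ 2)

/-- `z₁(λ)`, using the principal branch of the complex square root. -/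
def z1 (a β : ℝ) (lam : ℂ) : ℂ :=
  lam / (1 + (β : ℂ) ^ 2 / 2) + (a : ℂ) / 2 +
    Complex.I * (((|β| / Real.sqrt 2 : ℝ) : ℂ) / (1 + (β : ℂ) ^ 2 / 2)) *
      ((lam ^ 2 - (a : ℂ) ^ 2 * (1 + (β : ℂ) ^ 2 / 2) ^ 2 / (2 * (β : ℂ) ^ 2)) ^ ((1 : ℂ) / 2))

/-- `z₂(λ)`, using the principal branch of the complex square root. -/
def z2 (a β : ℝ) (lam : ℂ) : ℂ :=
  lam / (1 + (β : ℂ) ^ 2 / 2) + (a : ℂ) / 2 -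
    Complex.I * (((|β| / Real.sqrt 2 : ℝ) : ℂ) / (1 + (β : ℂ) ^ 2 / 2)) *
      ((lam ^ 2 - (a : ℂ) ^ 2 * (1 + (β : ℂ) ^ 2 / 2) ^ 2 / (2 * (β : ℂ) ^ 2)) ^ ((1 : ℂ) / 2))

/-- `B_a = √(λ + a + A²)` (principal branch). -/
def Ba (a : ℝ) (lam : ℂ) (A : ℝ) : ℂ := (lam + (a : ℂ) + (A : ℂ) ^ 2) ^ ((1 : ℂ) / 2)

/-- `L₁ = √(z₁(λ) + A²)` (principal branch). -/
def L1 (a β : ℝ) (lam : ℂ) (A : ℝ) : ℂ := (z1 a β lam + (A : ℂ) ^ 2) ^ ((1 : ℂ) / 2)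

/-- `L₂ = √(z₂(λ) + A²)` (principal branch). -/
def L2 (a β : ℝ) (lam : ℂ) (A : ℝ) : ℂ := (z2 a β lam + (A : ℂ) ^ 2) ^ ((1 : ℂ) / 2)

/-- The quantity `I₁`. -/
def calI1 (a β : ℝ) (lam : ℂ) (A : ℝ) : ℂ :=
  (β : ℂ) * ((A : ℂ) ^ 2 / ((Ba a lam A) ^ 2 - (A : ℂ) ^ 2)) *
    (2 * (A : ℂ) ^ 2 - (A : ℂ) * ((Ba a lam A) ^ 2 + (A : ℂ) ^ 2) / Ba a lam A)

/-- The quantity `I₂`. -/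
def calI2 (a β : ℝ) (lam : ℂ) (A : ℝ) : ℂ :=
  -(β : ℂ) * (L1 a β lam A * (L2 a β lam A - (A : ℂ)) /
        ((Ba a lam A) ^ 2 - (L1 a β lam A) ^ 2)) *
      (2 * (A : ℂ) ^ 2 * L1 a β lam A -
        ((Ba a lam A) ^ 2 + (A : ℂ) ^ 2) * ((L1 a β lam A) ^ 2 + (A : ℂ) ^ 2) /
          (2 * Ba a lam A)) +
    (β : ℂ) * (L2 a β lam A * (L1 a β lam A - (A : ℂ)) /
        ((Ba a lam A) ^ 2 - (L2 a β lam A) ^ 2)) *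
      (2 * (A : ℂ) ^ 2 * L2 a β lam A -
        ((Ba a lam A) ^ 2 + (A : ℂ) ^ 2) * ((L2 a β lam A) ^ 2 + (A : ℂ) ^ 2) /
          (2 * Ba a lam A))

/-- `𝒟(λ, ξ') = 2B_a(B_a² − L₁²)(B_a² − L₂²)(I₁ + I₂/(L₂ − L₁))`. -/
def calD (a β : ℝ) (lam : ℂ) (A : ℝ) : ℂ :=
  2 * Ba a lam A * ((Ba a lam A) ^ 2 - (L1 a β lam A) ^ 2) *
    ((Ba a lam A) ^ 2 - (L2 a β lam A) ^ 2) *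
    (calI1 a β lam A + calI2 a β lam A / (L2 a β lam A - L1 a β lam A))

/-- `𝒞_a(λ, ξ') = (1/λ)(I₁ + I₂/(L₂ − L₁))`. -/
def calC (a β : ℝ) (lam : ℂ) (A : ℝ) : ℂ :=
  (1 / lam) * (calI1 a β lam A + calI2 a β lam A / (L2 a β lam A - L1 a β lam A))

/-- The Lopatinski determinant `𝒜_a(λ, ξ') = B_a³(L₁ + L₂) − A²B_a² − A²L₁L₂`. -/
def calA (a β : ℝ) (lam : ℂ) (A : ℝ) : ℂ :=
  (Ba a lam A) ^ 3 * (L1 a β lam A + L2 a β lam A) - (A : ℂ) ^ 2 * (Ba a lam A) ^ 2 -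
    (A : ℂ) ^ 2 * L1 a β lam A * L2 a β lam A

/-- The algebraic sign condition cut out by the sector: `Re λ > -cos ε |λ|`. -/
lemma neg_cos_mul_norm_lt_re_of_mem_SectorS {ε : ℝ} (h₀ : 0 ≤ ε) {lam : ℂ}
    (h : lam ∈ SectorS ε) : -Real.cos ε * ‖lam‖ < lam.re := by
  obtain ⟨hne, harg⟩ := h
  have hcos : Real.cos (Real.pi - ε) < Real.cos |lam.arg| :=
    Real.cos_lt_cos_of_nonneg_of_le_pi (abs_nonneg _) (by linarith) harg
  rw [Real.cos_pi_sub, Real.cos_abs] at hcos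
  rw [← Complex.norm_mul_cos_arg lam, mul_comm ‖lam‖]
  exact mul_lt_mul_of_pos_right hcos (norm_pos_iff.mpr hne)

/-- The numbers `-z₁(λ)`, `-z₂(λ)` are the roots in `x` of the characteristic polynomial. -/
lemma z1_add_mul_z2_add {a β : ℝ} (hβ : β ≠ 0) (lam x : ℂ) :
    (1 + (β : ℂ) ^ 2 / 2) * ((z1 a β lam + x) * (z2 a β lam + x)) =
      (lam + x) * (lam + x + a) + (β : ℂ) ^ 2 / 2 * (x ^ 2 + a * x) := by
  have hβ' : (β : ℂ) ≠ 0 := by exact_mod_cast hβ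
  have hk : (1 + (β : ℂ) ^ 2 / 2) ≠ 0 := by
    have : (1 + β ^ 2 / 2 : ℝ) ≠ 0 := by positivity
    exact_mod_cast this
  have hs : (((|β| / Real.sqrt 2 : ℝ) : ℂ)) ^ 2 = (β : ℂ) ^ 2 / 2 := by
    have : (|β| / Real.sqrt 2) ^ 2 = β ^ 2 / 2 := by
      rw [div_pow, sq_abs, Real.sq_sqrt (by norm_num)]
    exact_mod_cast this
  unfold z1 z2
  set w := lam ^ 2 - (a : ℂ) ^ 2 * (1 + (β : ℂ) ^ 2 / 2) ^ 2 / (2 * (β : ℂ) ^ 2) with hw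
  have hr : (w ^ ((1 : ℂ) / 2)) ^ 2 = w := by
    rw [one_div]
    exact Complex.cpow_nat_inv_pow w two_ne_zero
  set r := w ^ ((1 : ℂ) / 2)
  set s : ℂ := ((|β| / Real.sqrt 2 : ℝ) : ℂ)
  set k : ℂ := 1 + (β : ℂ) ^ 2 / 2 with hkdef
  clear_value k
  calc k * ((lam / k + a / 2 + I * (s / k) * r + x) * (lam / k + a / 2 - I * (s / k) * r + x))
      = k * ((lam / k + a / 2 + x) ^ 2 - I ^ 2 * s ^ 2 / k ^ 2 * r ^ 2) := by ring
    _ = k * ((lam / k + a / 2 + x) ^ 2 + ((β : ℂ) ^ 2 / 2) / k ^ 2 * w) := by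
      rw [I_sq, hs, hr]; ring
    _ = _ := by
      have hb : (β : ℂ) ^ 2 = 2 * (k - 1) := by rw [hkdef]; ring
      have hk1 : k - 1 ≠ 0 := by
        rw [hkdef, add_sub_cancel_left]
        exact div_ne_zero (pow_ne_zero _ hβ') two_ne_zero
      rw [hw, hb]
      field_simp
      ring

/-- The characteristic polynomial has no zero with `x ≥ 0` and `λ` in a sector whose angle
satisfies `β² / 2 ≤ tan² ε`. -/
lemma charPoly_ne_zero_of_mem_SectorS {a b ε x : ℝ} (ha : 0 < a) (hb : 0 ≤ b) (hx : 0 ≤ x)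
    (hε₀ : 0 ≤ ε) (htan : b * Real.cos ε ^ 2 ≤ Real.sin ε ^ 2)
    {lam : ℂ} (h : lam ∈ SectorS ε) :
    (lam + x) * (lam + x + a) + (b : ℂ) * ((x : ℂ) ^ 2 + a * x) ≠ 0 := by
  intro h0
  have hre := neg_cos_mul_norm_lt_re_of_mem_SectorS hε₀ h
  have hnorm : ‖lam‖ ^ 2 = lam.re ^ 2 + lam.im ^ 2 := by
    rw [Complex.sq_norm, Complex.normSq_apply]; ring
  have hR := congrArg Complex.re h0
  have hI := congrArg Complex.im h0
  simp [pow_two] at hR hI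
  have hsc := Real.sin_sq_add_cos_sq ε
  have hsector : lam.re ≤ 0 →
      Real.sin ε ^ 2 * lam.re ^ 2 < Real.cos ε ^ 2 * lam.im ^ 2 := fun hle => by
    have hsq : (-lam.re) ^ 2 < (Real.cos ε * ‖lam‖) ^ 2 :=
      pow_lt_pow_left₀ (by linarith) (by linarith) two_ne_zero
    rw [mul_pow, hnorm] at hsq
    rw [show Real.sin ε ^ 2 = 1 - Real.cos ε ^ 2 by linarith]
    linarith
  have hbx : 0 ≤ b * (x * x + a * x) := by positivity
  have hv : lam.im * (2 * (lam.re + x) + a) = 0 := by linarith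
  rcases mul_eq_zero.mp hv with him | hu
  · have hpos : 0 < lam.re := by
      by_contra! hle
      have := hsector hle
      rw [him] at this
      nlinarith [mul_nonneg (sq_nonneg (Real.sin ε)) (sq_nonneg lam.re)]
    have : 0 < (lam.re + x) * (lam.re + x + a) := by positivity
    rw [him] at hR
    linarith
  · have hu' : lam.re = -(x + a / 2) := by linarith
    have hlt := hsector (by linarith)
    have him : lam.im ^ 2 = b * (x * x + a * x) - a ^ 2 / 4 := by
      rw [hu'] at hR; linarith
    have hle : lam.im ^ 2 ≤ b * lam.re ^ 2 := by
      rw [him, hu']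
      nlinarith [mul_nonneg hb (sq_nonneg a), sq_nonneg a]
    nlinarith [mul_le_mul_of_nonneg_left hle (sq_nonneg (Real.cos ε)),
      mul_le_mul_of_nonneg_right htan (sq_nonneg lam.re)]

theorem characteristic_roots_ne_zero
    (N : ℕ) (hN : 2 ≤ N) (a β ε₀ ε : ℝ)
    (ha : 0 < a) (hβ : β ≠ 0)
    (hε₀ : 0 < ε₀) (hε₀' : ε₀ < Real.pi / 2)
    (htan : |β| / Real.sqrt 2 ≤ Real.tan ε₀)
    (hε : ε₀ < ε) (hε' : ε < Real.pi / 2) :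
    ∀ ξ' : EuclideanSpace ℝ (Fin (N - 1)), ∀ lam ∈ SectorS ε,
      z1 a β lam + (‖ξ'‖ : ℂ) ^ 2 ≠ 0 ∧ z2 a β lam + (‖ξ'‖ : ℂ) ^ 2 ≠ 0 := by
  intro ξ' lam hlam
  have hcos : 0 < Real.cos ε := Real.cos_pos_of_mem_Ioo ⟨by linarith, hε'⟩
  have hle : |β| / Real.sqrt 2 ≤ Real.tan ε :=
    htan.trans (Real.tan_lt_tan_of_lt_of_lt_pi_div_two (by linarith) hε' hε).le
  have hb : β ^ 2 / 2 * Real.cos ε ^ 2 ≤ Real.sin ε ^ 2 := by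
    have hsq := pow_le_pow_left₀ (by positivity) hle 2
    rw [div_pow, sq_abs, Real.sq_sqrt (by norm_num), Real.tan_eq_sin_div_cos, div_pow] at hsq
    exact (le_div_iff₀ (by positivity)).mp hsq
  have hP := charPoly_ne_zero_of_mem_SectorS ha (by positivity) (sq_nonneg ‖ξ'‖)
    (hε₀.trans hε).le hb hlam
  push_cast at hP
  rw [← z1_add_mul_z2_add hβ] at hP
  exact mul_ne_zero_iff.mp (right_ne_zero_of_mul hP)
end
end

section
/- Let a > 0, β ∈ ℝ \ {0}, let ε₀ ∈ (0, π/2) satisfy tan ε₀ ≥ |β|/√2, and let ε ∈ (ε₀, π/2). Then there exists δ ∈ (0, π/2) such that for every λ ∈ Σ_ε and j ∈ {1, 2}, one has z_j(λ) ∈ Σ_δ; that is, z_j(λ) ≠ 0 and |arg z_j(λ)| < π − δ. -/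
noncomputable section

open Complex

/-- Two complex numbers with imaginary part at least `q ≥ 0` have a product outside
a parabolic neighbourhood of the positive real axis. -/
lemma two_mul_sq_le_norm_mul_sub_re {A B : ℂ} {q : ℝ} (hq : 0 ≤ q) (hA : q ≤ A.im)
    (hB : q ≤ B.im) : 2 * q ^ 2 ≤ ‖A * B‖ - (A * B).re := by
  have h1 : A.re * B.re + A.im * B.im ≤ ‖A * B‖ := by
    have h := Complex.re_le_norm (A * (starRingEnd ℂ) B)
    rw [norm_mul, RCLike.norm_conj, ← norm_mul] at h
    simpa using h
  rw [Complex.mul_re]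
  nlinarith [mul_le_mul hA hB hq (hq.trans hA)]

/-- If `1 / t` and `1 / (t + a)` lie in a closed half-plane (rotated by `e` to the lower one),
then a root `lam` of the characteristic equation cannot have `-1 / lam` well inside the opposite
half-plane. -/
lemma characteristic_ne_of_half_plane {a b : ℝ} {lam t e : ℂ} (hlam : lam ≠ 0) (ht : t ≠ 0)
    (hta : t + a ≠ 0) (h1 : (e / t).im ≤ 0) (h2 : (e / (t + a)).im ≤ 0)
    (hf : b * |(-(e / lam)).re| < (-(e / lam)).im) (hb : 0 ≤ b) :
    (lam + t) * (lam + t + a) ≠ -(b : ℂ) ^ 2 * (t * (t + a)) := by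
  intro h
  set f : ℂ := -(e / lam) with hfdef
  have hprod : (f - e / t) * (f - e / (t + a)) = ((-(b ^ 2) : ℝ) : ℂ) * (f * f) := by
    have : (f - e / t) * (f - e / (t + a)) =
        e ^ 2 * ((lam + t) * (lam + t + a)) / (lam ^ 2 * (t * (t + a))) := by
      rw [hfdef]; field_simp; ring
    rw [this, h, hfdef]; push_cast; field_simp
  have hq : 0 ≤ f.im := (mul_nonneg hb (abs_nonneg _)).trans hf.le
  have key := two_mul_sq_le_norm_mul_sub_re (A := f - e / t) (B := f - e / (t + a)) hq
    (by rw [Complex.sub_im]; linarith) (by rw [Complex.sub_im]; linarith)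
  rw [hprod, norm_mul, norm_mul, Complex.norm_real, Real.norm_eq_abs, abs_neg,
    abs_of_nonneg (sq_nonneg b), Complex.re_ofReal_mul, ← sq, Complex.sq_norm,
    Complex.normSq_apply, Complex.mul_re] at key
  have h3 : (b * |f.re|) ^ 2 < f.im ^ 2 := pow_lt_pow_left₀ hf (by positivity) two_ne_zero
  rw [mul_pow, sq_abs] at h3
  nlinarith

lemma mul_abs_cos_lt_sin {b ε₀ ψ : ℝ} (h0 : 0 < ε₀) (h0' : ε₀ < Real.pi / 2)
    (hb : b ≤ Real.tan ε₀) (h1 : ε₀ < ψ) (h2 : ψ < Real.pi - ε₀) :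
    b * |Real.cos ψ| < Real.sin ψ := by
  have hc : 0 < Real.cos ε₀ := Real.cos_pos_of_mem_Ioo ⟨by linarith, h0'⟩
  have hs1 : 0 < Real.sin (ψ - ε₀) := Real.sin_pos_of_pos_of_lt_pi (by linarith) (by linarith)
  have hs2 : 0 < Real.sin (ψ + ε₀) := Real.sin_pos_of_pos_of_lt_pi (by linarith) (by linarith)
  rw [Real.sin_sub] at hs1
  rw [Real.sin_add] at hs2
  refine (mul_le_mul_of_nonneg_right hb (abs_nonneg _)).trans_lt ?_
  rw [Real.tan_eq_sin_div_cos, div_mul_eq_mul_div, div_lt_iff₀ hc]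
  rcases abs_cases (Real.cos ψ) with ⟨h, -⟩ | ⟨h, -⟩ <;> rw [h] <;> linarith

lemma exp_div_polar (η ρ τ : ℝ) :
    Complex.exp (η * I) / (ρ * Complex.exp (τ * I)) =
      ((ρ⁻¹ : ℝ) : ℂ) * Complex.exp ((η - τ : ℝ) * I) := by
  rw [Complex.ofReal_sub, sub_mul, Complex.exp_sub, Complex.ofReal_inv, div_mul_eq_div_div_swap]
  ring

/-- The characteristic equation has no root with `lam` in the upper half of the sector `Σ_ε` and
`t` close to the positive real axis. -/
lemma characteristic_ne_of_angles {a b ε₀ ε δ r θ ρ τ : ℝ} (ha : 0 < a) (hb : 0 ≤ b)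
    (h0 : 0 < ε₀) (h0' : ε₀ < Real.pi / 2) (hbt : b ≤ Real.tan ε₀) (hδ : 0 < δ)
    (hδε : ε₀ + δ < ε) (hε' : ε < Real.pi / 2) (hr : 0 < r) (hθ : 0 ≤ θ)
    (hθ' : θ < Real.pi - ε) (hρ : 0 < ρ) (hτ : |τ| ≤ δ) {lam t : ℂ}
    (hlam : lam = r * Complex.exp (θ * I)) (ht : t = ρ * Complex.exp (τ * I)) :
    (lam + t) * (lam + t + a) ≠ -(b : ℂ) ^ 2 * (t * (t + a)) := by
  obtain ⟨hτ1, hτ2⟩ := abs_le.mp hτ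
  obtain ⟨η, hη1, hη2, hη3, hη4⟩ : ∃ η : ℝ, -Real.pi + δ ≤ η ∧ η ≤ -δ ∧
      ε₀ < Real.pi + η - θ ∧ Real.pi + η - θ < Real.pi - ε₀ := by
    rcases le_total θ (Real.pi / 2 - δ) with h | h
    · exact ⟨θ - Real.pi / 2, by linarith, by linarith, by linarith, by linarith⟩
    · exact ⟨-δ, by linarith, by linarith, by linarith, by linarith⟩
  have htre : 0 < t.re := by
    rw [ht, Complex.re_ofReal_mul, Complex.exp_ofReal_mul_I_re]
    exact mul_pos hρ (Real.cos_pos_of_mem_Ioo ⟨by linarith, by linarith⟩)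
  have ht0 : t ≠ 0 := fun h => by simp [h] at htre
  have hta0 : t + a ≠ 0 := fun h => by
    have := congrArg Complex.re h
    simp at this
    linarith
  have him : (Complex.exp (η * I) / t).im ≤ 0 := by
    rw [ht, exp_div_polar, Complex.im_ofReal_mul, Complex.exp_ofReal_mul_I_im]
    exact mul_nonpos_of_nonneg_of_nonpos (inv_nonneg.mpr hρ.le)
      (Real.sin_nonpos_of_nonpos_of_neg_pi_le (by linarith) (by linarith))
  have hsin : Real.sin η ≤ 0 :=
    Real.sin_nonpos_of_nonpos_of_neg_pi_le (by linarith) (by linarith)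
  have him' : (Complex.exp (η * I) / (t + a)).im ≤ 0 := by
    have hN : 0 < Complex.normSq t := Complex.normSq_pos.mpr ht0
    rw [Complex.div_im, ← sub_div, div_nonpos_iff] at him ⊢
    have h1 := him.resolve_left fun h => hN.not_ge h.2
    refine Or.inr ⟨?_, Complex.normSq_nonneg _⟩
    rw [Complex.exp_ofReal_mul_I_re, Complex.exp_ofReal_mul_I_im] at h1 ⊢
    simp only [Complex.add_re, Complex.add_im, Complex.ofReal_re, Complex.ofReal_im]
    nlinarith [h1.1]
  refine characteristic_ne_of_half_plane (e := Complex.exp (η * I)) ?_ ht0 hta0 him him' ?_ hb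
  · rw [hlam]
    exact mul_ne_zero (by exact_mod_cast hr.ne') (Complex.exp_ne_zero _)
  · have key := mul_abs_cos_lt_sin h0 h0' hbt hη3 hη4
    rw [add_sub_assoc, add_comm, Real.cos_add_pi, Real.sin_add_pi] at key
    rw [hlam, exp_div_polar, Complex.neg_re, Complex.neg_im, Complex.re_ofReal_mul,
      Complex.im_ofReal_mul, Complex.exp_ofReal_mul_I_re, Complex.exp_ofReal_mul_I_im, abs_neg,
      abs_mul, abs_of_pos (inv_pos.mpr hr)]
    rw [abs_neg] at key
    nlinarith [mul_lt_mul_of_pos_left key (inv_pos.mpr hr)]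

/-- A root `z` of the characteristic equation with `lam ∈ Σ_ε` lies in `Σ_δ` as soon as
`ε₀ + δ < ε`. -/
lemma mem_sectorS_of_characteristic {a b ε₀ ε δ : ℝ} (ha : 0 < a) (hb : 0 ≤ b)
    (h0 : 0 < ε₀) (h0' : ε₀ < Real.pi / 2) (hbt : b ≤ Real.tan ε₀) (hδ : 0 < δ)
    (hδε : ε₀ + δ < ε) (hε' : ε < Real.pi / 2) {lam z : ℂ} (hlam : lam ∈ SectorS ε)
    (h : (lam - z) * (lam - z + a) = -(b : ℂ) ^ 2 * (z * (z - a))) :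
    z ∈ SectorS δ := by
  obtain ⟨hlam0, harg⟩ := hlam
  obtain ⟨harg1, harg2⟩ := abs_lt.mp harg
  have hz : z ≠ 0 := by
    rintro rfl
    have h1 : lam * (lam + a) = 0 := by simpa using h
    have h2 : lam = ((-a : ℝ) : ℂ) := by
      push_cast
      exact eq_neg_of_add_eq_zero_left ((mul_eq_zero.mp h1).resolve_left hlam0)
    rw [h2, Complex.arg_ofReal_of_neg (by linarith)] at harg2
    linarith
  refine ⟨hz, ?_⟩
  by_contra! hcon
  obtain ⟨τ, hτ, hzτ⟩ : ∃ τ : ℝ, |τ| ≤ δ ∧ -z = (‖z‖ : ℝ) * Complex.exp (τ * I) := by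
    have hpol := Complex.norm_mul_exp_arg_mul_I z
    rcases le_abs.mp hcon with hc | hc
    · refine ⟨z.arg - Real.pi, abs_le.mpr ⟨by linarith, by linarith [Complex.arg_le_pi z]⟩, ?_⟩
      rw [Complex.ofReal_sub, sub_mul, Complex.exp_sub, Complex.exp_pi_mul_I, div_neg, div_one,
        mul_neg, hpol]
    · refine ⟨z.arg + Real.pi,
        abs_le.mpr ⟨by linarith [Complex.neg_pi_lt_arg z], by linarith⟩, ?_⟩
      rw [Complex.ofReal_add, add_mul, Complex.exp_add, Complex.exp_pi_mul_I, mul_neg, mul_one,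
        mul_neg, hpol]
  have hpol := Complex.norm_mul_exp_arg_mul_I lam
  have heq : (lam + -z) * (lam + -z + a) = -(b : ℂ) ^ 2 * (-z * (-z + a)) := by
    linear_combination h
  rcases le_total 0 lam.arg with hs | hs
  · exact characteristic_ne_of_angles ha hb h0 h0' hbt hδ hδε hε' (norm_pos_iff.mpr hlam0) hs
      harg2 (norm_pos_iff.mpr hz) hτ hpol.symm hzτ heq
  · have hconj : ∀ x : ℝ, (starRingEnd ℂ) (Complex.exp (x * I)) =
        Complex.exp ((-x : ℝ) * I) := fun x => by
      rw [← Complex.exp_conj]; simp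
    refine characteristic_ne_of_angles (θ := -lam.arg) (τ := -τ)
      (lam := (starRingEnd ℂ) lam) (t := (starRingEnd ℂ) (-z)) ha hb h0 h0' hbt hδ hδε hε'
      (norm_pos_iff.mpr hlam0) (by linarith) (by linarith) (norm_pos_iff.mpr hz)
      (by rwa [abs_neg]) ?_ ?_ ?_
    · rw [← hconj, ← Complex.conj_ofReal ‖lam‖, ← map_mul, hpol]
    · rw [← hconj, ← Complex.conj_ofReal ‖z‖, ← map_mul, hzτ]
    · simpa using congrArg (starRingEnd ℂ) heq

lemma characteristic_of_sq {a β : ℝ} (hβ : β ≠ 0) {lam s z : ℂ}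
    (hs : s ^ 2 = lam ^ 2 -
      (a : ℂ) ^ 2 * (1 + (β : ℂ) ^ 2 / 2) ^ 2 / (2 * (β : ℂ) ^ 2))
    (hz : z = lam / (1 + (β : ℂ) ^ 2 / 2) + (a : ℂ) / 2 +
      Complex.I * (((|β| / Real.sqrt 2 : ℝ) : ℂ) / (1 + (β : ℂ) ^ 2 / 2)) * s) :
    (lam - z) * (lam - z + a) = -((|β| / Real.sqrt 2 : ℝ) : ℂ) ^ 2 * (z * (z - a)) := by
  have hb2 : ((|β| / Real.sqrt 2 : ℝ) : ℂ) ^ 2 = (β : ℂ) ^ 2 / 2 := by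
    rw [← Complex.ofReal_pow, div_pow, sq_abs, Real.sq_sqrt two_pos.le]
    push_cast; rfl
  set b : ℂ := ((|β| / Real.sqrt 2 : ℝ) : ℂ)
  have hβ' : (β : ℂ) ≠ 0 := by exact_mod_cast hβ
  have hβ2 : (β : ℂ) ^ 2 = 2 * b ^ 2 := by rw [hb2]; ring
  have hb0 : b ≠ 0 := fun h => by simp [h, hβ'] at hβ2
  have hc : 1 + b ^ 2 ≠ 0 := by
    rw [hb2]
    exact_mod_cast (by positivity : (1 + β ^ 2 / 2 : ℝ) ≠ 0)
  rw [hβ2, mul_div_cancel_left₀ _ (two_ne_zero' ℂ)] at hs hz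
  have hw : (1 + b ^ 2) * z - lam - a / 2 * (1 + b ^ 2) = I * b * s := by
    rw [hz]; field_simp; ring
  have hs' : 4 * b ^ 2 * s ^ 2 = 4 * b ^ 2 * lam ^ 2 - a ^ 2 * (1 + b ^ 2) ^ 2 := by
    rw [hs]; field_simp; ring
  have hw2 := congrArg (· ^ 2) hw
  simp only [mul_pow, Complex.I_sq] at hw2
  apply mul_left_cancel₀ hc
  linear_combination hw2 - hs' / 4

theorem z_in_sector
    (a β ε₀ ε : ℝ)
    (ha : 0 < a) (hβ : β ≠ 0)
    (hε₀ : 0 < ε₀) (hε₀' : ε₀ < Real.pi / 2)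
    (htan : |β| / Real.sqrt 2 ≤ Real.tan ε₀)
    (hε : ε₀ < ε) (hε' : ε < Real.pi / 2) :
    ∃ δ : ℝ, 0 < δ ∧ δ < Real.pi / 2 ∧ ∀ lam ∈ SectorS ε,
      (z1 a β lam ≠ 0 ∧ |(z1 a β lam).arg| < Real.pi - δ) ∧
      (z2 a β lam ≠ 0 ∧ |(z2 a β lam).arg| < Real.pi - δ) := by
  have hmem : ∀ lam ∈ SectorS ε, ∀ z s : ℂ,
      s ^ 2 = lam ^ 2 - (a : ℂ) ^ 2 * (1 + (β : ℂ) ^ 2 / 2) ^ 2 / (2 * (β : ℂ) ^ 2) →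
      z = lam / (1 + (β : ℂ) ^ 2 / 2) + (a : ℂ) / 2 +
        Complex.I * (((|β| / Real.sqrt 2 : ℝ) : ℂ) / (1 + (β : ℂ) ^ 2 / 2)) * s →
      z ∈ SectorS ((ε - ε₀) / 2) := fun lam hlam z s hs hz =>
    mem_sectorS_of_characteristic ha (by positivity) hε₀ hε₀' htan (by linarith) (by linarith)
      hε' hlam (characteristic_of_sq hβ hs hz)
  have hsq : ∀ x : ℂ, (x ^ ((1 : ℂ) / 2)) ^ 2 = x := fun x => by
    simp
  refine ⟨(ε - ε₀) / 2, by linarith, by linarith, fun lam hlam => ⟨?_, ?_⟩⟩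
  · exact hmem lam hlam _ _ (hsq _) rfl
  · refine hmem lam hlam _ (-_) ((neg_sq _).trans (hsq _)) ?_
    rw [z2, mul_neg, sub_eq_add_neg]
end
end

section
/- Let N ≥ 2, a > 0, β ∈ ℝ \ {0}, let ε₀ ∈ (0, π/2) satisfy tan ε₀ ≥ |β|/√2, and let ε ∈ (ε₀, π/2). Fix ξ' ∈ ℝ^{N−1} \ {0} and set A = |ξ'|. Then, as λ → 0 within Σ_ε, λ·𝒞_a(λ, ξ') converges to −a²/(2βA(√(a + A²) − A)); equivalently, λ·𝒞_a(λ, ξ') = −a²/(2βA(√(a + A²) − A)) + o(1) as |λ| → 0, λ ∈ Σ_ε. -/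
noncomputable section

open Complex

open Filter Topology

lemma cpow_half_sq (w : ℂ) : (w ^ ((1 : ℂ) / 2)) ^ 2 = w := by
  rw [one_div]
  exact_mod_cast cpow_nat_inv_pow w (n := 2) two_ne_zero

lemma ofReal_sq_cpow_half {r : ℝ} (hr : 0 ≤ r) : ((r : ℂ) ^ 2) ^ ((1 : ℂ) / 2) = (r : ℂ) := by
  have h : ((r : ℂ) ^ 2) ^ ((1 : ℂ) / 2) = (((r ^ 2) ^ ((1 : ℝ) / 2) : ℝ) : ℂ) := by
    rw [ofReal_cpow (by positivity)]
    push_cast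
    rfl
  rw [h, ← Real.sqrt_eq_rpow, Real.sqrt_sq hr]

lemma tendsto_cpow_half {α : Type*} {l : Filter α} {f : α → ℂ} {r : ℝ} (hr : 0 < r)
    (hf : Tendsto f l (𝓝 ((r : ℂ) ^ 2))) :
    Tendsto (fun x => f x ^ ((1 : ℂ) / 2)) l (𝓝 (r : ℂ)) := by
  have hs : ((r : ℂ) ^ 2) ∈ slitPlane := by
    rw [← ofReal_pow, ofReal_mem_slitPlane]
    positivity
  have h := (continuousAt_cpow_const (b := (1 : ℂ) / 2) hs).tendsto.comp hf
  rwa [ofReal_sq_cpow_half hr.le] at h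

/-- The combination `I₁ + I₂ / (y - x)` as a function of `b = B_a`, `x = L₁` and `y = L₂`. -/
def boundarySymbol (β A b x y : ℂ) : ℂ :=
  β * (A ^ 2 / (b ^ 2 - A ^ 2)) * (2 * A ^ 2 - A * (b ^ 2 + A ^ 2) / b) +
    (-β * (x * (y - A) / (b ^ 2 - x ^ 2)) *
        (2 * A ^ 2 * x - (b ^ 2 + A ^ 2) * (x ^ 2 + A ^ 2) / (2 * b)) +
      β * (y * (x - A) / (b ^ 2 - y ^ 2)) *
        (2 * A ^ 2 * y - (b ^ 2 + A ^ 2) * (y ^ 2 + A ^ 2) / (2 * b))) / (y - x)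

lemma boundarySymbol_comm (β A b x y : ℂ) :
    boundarySymbol β A b x y = boundarySymbol β A b y x := by
  unfold boundarySymbol
  rw [← neg_sub x y, div_neg]
  ring

lemma tendsto_boundarySymbol {α : Type*} {l : Filter α} {b x y : α → ℂ} {β A B : ℝ}
    (hβ : β ≠ 0) (hA : 0 < A) (hAB : A < B)
    (hb : Tendsto b l (𝓝 (B : ℂ))) (hx : Tendsto x l (𝓝 (A : ℂ)))
    (hy : Tendsto y l (𝓝 (B : ℂ)))
    (hr : Tendsto (fun t => (x t - A) / (b t ^ 2 - y t ^ 2)) l (𝓝 (1 / ((A : ℂ) * (β : ℂ) ^ 2)))) :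
    Tendsto (fun t => boundarySymbol β A (b t) (x t) (y t)) l
      (𝓝 (-((B : ℂ) ^ 2 - (A : ℂ) ^ 2) ^ 2 / (2 * β * A * (B - A)))) := by
  have hβ' : (β : ℂ) ≠ 0 := mod_cast hβ
  have hA' : (A : ℂ) ≠ 0 := mod_cast hA.ne'
  have hB' : (B : ℂ) ≠ 0 := mod_cast (hA.trans hAB).ne'
  have hd : (B : ℂ) - A ≠ 0 := sub_ne_zero.mpr (mod_cast hAB.ne')
  have hs : (B : ℂ) + A ≠ 0 := mod_cast (by linarith : 0 < B + A).ne'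
  have hsq : (B : ℂ) ^ 2 - (A : ℂ) ^ 2 ≠ 0 := by
    rw [sq_sub_sq]
    exact mul_ne_zero hs hd
  have h2b : Tendsto (fun t => 2 * b t) l (𝓝 (2 * (B : ℂ))) := hb.const_mul 2
  have h2B : 2 * (B : ℂ) ≠ 0 := mul_ne_zero two_ne_zero hB'
  have hI₁ := (((tendsto_const_nhds (x := (A : ℂ) ^ 2)).div ((hb.pow 2).sub_const _) hsq).const_mul
    (β : ℂ)).mul ((((hb.pow 2).add_const ((A : ℂ) ^ 2)).const_mul (A : ℂ)).div hb hB' |>.const_sub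
      (2 * (A : ℂ) ^ 2))
  have hF : ∀ {z : α → ℂ} {Z : ℂ}, Tendsto z l (𝓝 Z) →
      Tendsto (fun t => 2 * (A : ℂ) ^ 2 * z t -
        (b t ^ 2 + (A : ℂ) ^ 2) * (z t ^ 2 + (A : ℂ) ^ 2) / (2 * b t)) l
        (𝓝 (2 * (A : ℂ) ^ 2 * Z -
          ((B : ℂ) ^ 2 + (A : ℂ) ^ 2) * (Z ^ 2 + (A : ℂ) ^ 2) / (2 * (B : ℂ)))) := fun hz =>
    (hz.const_mul _).sub ((((hb.pow 2).add_const _).mul ((hz.pow 2).add_const _)).div h2b h2B)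
  have hT₁ := (((hx.mul (hy.sub_const (A : ℂ))).div ((hb.pow 2).sub (hx.pow 2)) hsq).const_mul
    (-(β : ℂ))).mul (hF hx)
  have hT₂ := ((hy.mul hr).const_mul (β : ℂ)).mul (hF hy)
  have h := hI₁.add ((hT₁.add hT₂).div (hy.sub hx) hd)
  refine Eq.subst (motive := fun v => Tendsto _ l (𝓝 v)) ?_ (h.congr fun t => ?_)
  · rw [sq_sub_sq] at *
    field_simp
    ring
  · simp only [boundarySymbol, Pi.div_apply, mul_div_assoc]

section SpectralRoots

variable {a β : ℝ}

/-- The root of the pair `z₁`, `z₂` that vanishes at `λ = 0`. -/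
def zSmall (a β : ℝ) (lam : ℂ) : ℂ :=
  lam / (1 + (β : ℂ) ^ 2 / 2) + (a : ℂ) / 2 -
    (((|β| / Real.sqrt 2 : ℝ) : ℂ) / (1 + (β : ℂ) ^ 2 / 2)) *
      (((a : ℂ) ^ 2 * (1 + (β : ℂ) ^ 2 / 2) ^ 2 / (2 * (β : ℂ) ^ 2) - lam ^ 2) ^ ((1 : ℂ) / 2))

/-- The root of the pair `z₁`, `z₂` that equals `a` at `λ = 0`. -/
def zLarge (a β : ℝ) (lam : ℂ) : ℂ :=
  lam / (1 + (β : ℂ) ^ 2 / 2) + (a : ℂ) / 2 +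
    (((|β| / Real.sqrt 2 : ℝ) : ℂ) / (1 + (β : ℂ) ^ 2 / 2)) *
      (((a : ℂ) ^ 2 * (1 + (β : ℂ) ^ 2 / 2) ^ 2 / (2 * (β : ℂ) ^ 2) - lam ^ 2) ^ ((1 : ℂ) / 2))

lemma z1_z2_eq_zSmall_zLarge (a β : ℝ) (lam : ℂ) :
    (z1 a β lam = zSmall a β lam ∧ z2 a β lam = zLarge a β lam) ∨
      (z1 a β lam = zLarge a β lam ∧ z2 a β lam = zSmall a β lam) := by
  set r : ℂ := (a : ℂ) ^ 2 * (1 + (β : ℂ) ^ 2 / 2) ^ 2 / (2 * (β : ℂ) ^ 2) with hr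
  have h : ((lam ^ 2 - r) ^ ((1 : ℂ) / 2)) ^ 2 = (I * (r - lam ^ 2) ^ ((1 : ℂ) / 2)) ^ 2 := by
    rw [mul_pow, cpow_half_sq, cpow_half_sq, I_sq]
    ring
  unfold z1 z2 zSmall zLarge
  rw [← hr]
  set k : ℂ := ((|β| / Real.sqrt 2 : ℝ) : ℂ) / (1 + (β : ℂ) ^ 2 / 2)
  rcases sq_eq_sq_iff_eq_or_eq_neg.mp h with h | h
  · left
    constructor
    · linear_combination I * k * h + k * (r - lam ^ 2) ^ ((1 : ℂ) / 2) * I_sq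
    · linear_combination -I * k * h - k * (r - lam ^ 2) ^ ((1 : ℂ) / 2) * I_sq
  · right
    constructor
    · linear_combination I * k * h - k * (r - lam ^ 2) ^ ((1 : ℂ) / 2) * I_sq
    · linear_combination -I * k * h + k * (r - lam ^ 2) ^ ((1 : ℂ) / 2) * I_sq

lemma one_add_sq_half_ne_zero (β : ℝ) : (1 : ℂ) + (β : ℂ) ^ 2 / 2 ≠ 0 := by
  have h : (1 : ℝ) + β ^ 2 / 2 ≠ 0 := by positivity
  exact_mod_cast h

lemma abs_div_sqrt_two_sq (β : ℝ) : ((|β| / Real.sqrt 2 : ℝ) : ℂ) ^ 2 = (β : ℂ) ^ 2 / 2 := by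
  have h : (|β| / Real.sqrt 2) ^ 2 = β ^ 2 / 2 := by
    rw [div_pow, sq_abs, Real.sq_sqrt zero_le_two]
  exact_mod_cast h

lemma zSmall_add_zLarge (a β : ℝ) (lam : ℂ) :
    zSmall a β lam + zLarge a β lam = 2 * lam / (1 + (β : ℂ) ^ 2 / 2) + a := by
  unfold zSmall zLarge
  ring

lemma zSmall_mul_zLarge (hβ : β ≠ 0) (lam : ℂ) :
    zSmall a β lam * zLarge a β lam = lam * ((lam + a) / (1 + (β : ℂ) ^ 2 / 2)) := by
  have hβ' : (β : ℂ) ≠ 0 := mod_cast hβ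
  have hk := one_add_sq_half_ne_zero β
  unfold zSmall zLarge
  rw [← sub_eq_zero]
  set k : ℂ := 1 + (β : ℂ) ^ 2 / 2 with hk_def
  set s := (((a : ℂ) ^ 2 * k ^ 2 / (2 * (β : ℂ) ^ 2) - lam ^ 2) ^ ((1 : ℂ) / 2)) with hs_def
  have hs : s ^ 2 = (a : ℂ) ^ 2 * k ^ 2 / (2 * (β : ℂ) ^ 2) - lam ^ 2 := cpow_half_sq _
  set c : ℂ := ((|β| / Real.sqrt 2 : ℝ) : ℂ)
  have hc : c ^ 2 = (β : ℂ) ^ 2 / 2 := abs_div_sqrt_two_sq β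
  have h₁ : (lam / k + a / 2 - c / k * s) * (lam / k + a / 2 + c / k * s) =
      (lam / k + a / 2) ^ 2 - c ^ 2 / k ^ 2 * s ^ 2 := by ring_nf
  have h₂ : c ^ 2 = k - 1 := by rw [hc, hk_def]; ring
  have h₃ : c ^ 2 * s ^ 2 = (a : ℂ) ^ 2 * k ^ 2 / 4 - (k - 1) * lam ^ 2 := by
    rw [hs, mul_sub, ← h₂, hc]
    field_simp
    ring
  rw [h₁, div_mul_eq_mul_div, h₃]
  field_simp
  ring

lemma tendsto_sqrt_discriminant (ha : 0 < a) (hβ : β ≠ 0) :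
    Tendsto (fun lam : ℂ => ((|β| / Real.sqrt 2 : ℝ) : ℂ) / (1 + (β : ℂ) ^ 2 / 2) *
      (((a : ℂ) ^ 2 * (1 + (β : ℂ) ^ 2 / 2) ^ 2 / (2 * (β : ℂ) ^ 2) - lam ^ 2) ^ ((1 : ℂ) / 2)))
      (𝓝 0) (𝓝 ((a : ℂ) / 2)) := by
  have hβ' : 0 < |β| := abs_pos.mpr hβ
  have hr : 0 < a * (1 + β ^ 2 / 2) / (Real.sqrt 2 * |β|) := by positivity
  have hlim : Tendsto (fun lam : ℂ =>
      (a : ℂ) ^ 2 * (1 + (β : ℂ) ^ 2 / 2) ^ 2 / (2 * (β : ℂ) ^ 2) - lam ^ 2) (𝓝 0)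
      (𝓝 (((a * (1 + β ^ 2 / 2) / (Real.sqrt 2 * |β|) : ℝ) : ℂ) ^ 2)) := by
    have hsq : (a * (1 + β ^ 2 / 2) / (Real.sqrt 2 * |β|)) ^ 2 =
        a ^ 2 * (1 + β ^ 2 / 2) ^ 2 / (2 * β ^ 2) - 0 ^ 2 := by
      rw [div_pow, mul_pow, mul_pow, sq_abs, Real.sq_sqrt zero_le_two]
      ring
    rw [← ofReal_pow ( _ / _ ), hsq]
    push_cast
    exact (tendsto_id.pow 2).const_sub _
  convert (tendsto_cpow_half hr hlim).const_mul _ using 2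
  have h : a / 2 = |β| / Real.sqrt 2 / (1 + β ^ 2 / 2) *
      (a * (1 + β ^ 2 / 2) / (Real.sqrt 2 * |β|)) := by
    have hk : 1 + β ^ 2 / 2 ≠ 0 := by positivity
    have h2 : Real.sqrt 2 ^ 2 = 2 := Real.sq_sqrt zero_le_two
    have h2' : Real.sqrt 2 ≠ 0 := by positivity
    calc a / 2 = a / Real.sqrt 2 ^ 2 := by rw [h2]
      _ = _ := by field_simp
  exact_mod_cast congrArg ((↑) : ℝ → ℂ) h

lemma tendsto_zSmall (ha : 0 < a) (hβ : β ≠ 0) :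
    Tendsto (zSmall a β) (𝓝 0) (𝓝 0) := by
  have h := ((tendsto_id (α := ℂ)).div_const (1 + (β : ℂ) ^ 2 / 2) |>.add_const ((a : ℂ) / 2)).sub
    (tendsto_sqrt_discriminant ha hβ)
  refine Eq.subst (motive := fun v => Tendsto _ (𝓝 0) (𝓝 v)) ?_ h
  simp

lemma tendsto_zLarge (ha : 0 < a) (hβ : β ≠ 0) :
    Tendsto (zLarge a β) (𝓝 0) (𝓝 (a : ℂ)) := by
  have h := ((tendsto_id (α := ℂ)).div_const (1 + (β : ℂ) ^ 2 / 2) |>.add_const ((a : ℂ) / 2)).add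
    (tendsto_sqrt_discriminant ha hβ)
  refine Eq.subst (motive := fun v => Tendsto _ (𝓝 0) (𝓝 v)) ?_ h
  simp

end SpectralRoots

lemma calI1_add_calI2_div (a β : ℝ) (lam : ℂ) (A : ℝ) :
    calI1 a β lam A + calI2 a β lam A / (L2 a β lam A - L1 a β lam A) =
      boundarySymbol β A (Ba a lam A) ((zSmall a β lam + (A : ℂ) ^ 2) ^ ((1 : ℂ) / 2))
        ((zLarge a β lam + (A : ℂ) ^ 2) ^ ((1 : ℂ) / 2)) := by
  have h : calI1 a β lam A + calI2 a β lam A / (L2 a β lam A - L1 a β lam A) =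
      boundarySymbol β A (Ba a lam A) (L1 a β lam A) (L2 a β lam A) := rfl
  rw [h]
  rcases z1_z2_eq_zSmall_zLarge a β lam with ⟨h₁, h₂⟩ | ⟨h₁, h₂⟩
  · rw [L1, L2, h₁, h₂]
  · rw [L1, L2, h₁, h₂, boundarySymbol_comm]

lemma tendsto_lam_mul_calC {a β A : ℝ} (ha : 0 < a) (hβ : β ≠ 0) (hA : 0 < A) :
    Tendsto (fun lam : ℂ => lam * calC a β lam A) (𝓝[≠] 0)
      (𝓝 ((-a ^ 2 / (2 * β * A * (Real.sqrt (a + A ^ 2) - A)) : ℝ) : ℂ)) := by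
  set B := Real.sqrt (a + A ^ 2) with hB
  have hBsq : B ^ 2 = a + A ^ 2 := Real.sq_sqrt (by positivity)
  have hBsq' : (B : ℂ) ^ 2 = a + (A : ℂ) ^ 2 := mod_cast congrArg ((↑) : ℝ → ℂ) hBsq
  have hB0 : 0 < B := Real.sqrt_pos.mpr (by positivity)
  have hAB : A < B := Real.lt_sqrt_of_sq_lt (by linarith)
  have ha' : (a : ℂ) ≠ 0 := mod_cast ha.ne'
  have hA' : (A : ℂ) ≠ 0 := mod_cast hA.ne'
  have hβ' : (β : ℂ) ≠ 0 := mod_cast hβ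
  have hk := one_add_sq_half_ne_zero β
  have hlam : Tendsto (fun lam : ℂ => lam) (𝓝[≠] 0) (𝓝 0) := tendsto_id.mono_left nhdsWithin_le_nhds
  have hzs := (tendsto_zSmall ha hβ).mono_left (nhdsWithin_le_nhds (s := {0}ᶜ))
  have hzl := (tendsto_zLarge ha hβ).mono_left (nhdsWithin_le_nhds (s := {0}ᶜ))
  have hb : Tendsto (fun lam => Ba a lam A) (𝓝[≠] 0) (𝓝 (B : ℂ)) := by
    refine tendsto_cpow_half hB0 ?_
    rw [hBsq']
    simpa using (hlam.add_const (a : ℂ)).add_const ((A : ℂ) ^ 2)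
  have hx : Tendsto (fun lam => (zSmall a β lam + (A : ℂ) ^ 2) ^ ((1 : ℂ) / 2)) (𝓝[≠] 0)
      (𝓝 (A : ℂ)) :=
    tendsto_cpow_half hA (by simpa using hzs.add_const ((A : ℂ) ^ 2))
  have hy : Tendsto (fun lam => (zLarge a β lam + (A : ℂ) ^ 2) ^ ((1 : ℂ) / 2)) (𝓝[≠] 0)
      (𝓝 (B : ℂ)) :=
    tendsto_cpow_half hB0 (by rw [hBsq']; exact hzl.add_const ((A : ℂ) ^ 2))
  have hq : Tendsto (fun lam => (lam + (a : ℂ)) / (1 + (β : ℂ) ^ 2 / 2) / zLarge a β lam) (𝓝[≠] 0)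
      (𝓝 (1 / (1 + (β : ℂ) ^ 2 / 2))) := by
    refine Eq.subst (motive := fun v => Tendsto _ _ (𝓝 v)) ?_
      (((hlam.add_const (a : ℂ)).div_const (1 + (β : ℂ) ^ 2 / 2)).div hzl ha')
    rw [zero_add, div_right_comm, div_self ha']
  have h2A : (A : ℂ) + A ≠ 0 := by
    rw [← two_mul]
    exact mul_ne_zero two_ne_zero hA'
  have hden : (1 - 2 / (1 + (β : ℂ) ^ 2 / 2)) + 1 / (1 + (β : ℂ) ^ 2 / 2) =
      (β : ℂ) ^ 2 / 2 / (1 + (β : ℂ) ^ 2 / 2) := by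
    rw [eq_div_iff hk, add_mul, sub_mul, div_mul_cancel₀ _ hk, div_mul_cancel₀ _ hk]
    ring
  have hden0 : (1 - 2 / (1 + (β : ℂ) ^ 2 / 2)) + 1 / (1 + (β : ℂ) ^ 2 / 2) ≠ 0 := by
    rw [hden]
    exact div_ne_zero (div_ne_zero (pow_ne_zero 2 hβ') two_ne_zero) hk
  have hr : Tendsto (fun lam => ((zSmall a β lam + (A : ℂ) ^ 2) ^ ((1 : ℂ) / 2) - A) /
      (Ba a lam A ^ 2 - ((zLarge a β lam + (A : ℂ) ^ 2) ^ ((1 : ℂ) / 2)) ^ 2)) (𝓝[≠] 0)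
      (𝓝 (1 / ((A : ℂ) * (β : ℂ) ^ 2))) := by
    have h := (hq.div (hx.add_const (A : ℂ)) h2A).div
      (hq.const_add (1 - 2 / (1 + (β : ℂ) ^ 2 / 2))) hden0
    have hlim : 1 / (1 + (β : ℂ) ^ 2 / 2) / ((A : ℂ) + A) /
        ((1 - 2 / (1 + (β : ℂ) ^ 2 / 2)) + 1 / (1 + (β : ℂ) ^ 2 / 2)) =
        1 / ((A : ℂ) * (β : ℂ) ^ 2) := by
      rw [hden, ← two_mul]
      generalize (1 : ℂ) + (β : ℂ) ^ 2 / 2 = k at hk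
      field_simp
    rw [hlim] at h
    refine h.congr' ?_
    filter_upwards [self_mem_nhdsWithin, hzl.eventually_ne ha',
      (hx.add_const (A : ℂ)).eventually_ne h2A] with lam hlam0 hzl0 hxA
    have hzs_eq : zSmall a β lam =
        lam * ((lam + (a : ℂ)) / (1 + (β : ℂ) ^ 2 / 2) / zLarge a β lam) := by
      rw [← mul_div_assoc, ← zSmall_mul_zLarge hβ, mul_div_cancel_right₀ _ hzl0]
    have hnum : (zSmall a β lam + (A : ℂ) ^ 2) ^ ((1 : ℂ) / 2) - A =
        lam * ((lam + (a : ℂ)) / (1 + (β : ℂ) ^ 2 / 2) / zLarge a β lam /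
          ((zSmall a β lam + (A : ℂ) ^ 2) ^ ((1 : ℂ) / 2) + A)) := by
      rw [← mul_div_assoc, ← hzs_eq, eq_div_iff hxA]
      linear_combination cpow_half_sq (zSmall a β lam + (A : ℂ) ^ 2)
    have hdenom : Ba a lam A ^ 2 - ((zLarge a β lam + (A : ℂ) ^ 2) ^ ((1 : ℂ) / 2)) ^ 2 =
        lam * ((1 - 2 / (1 + (β : ℂ) ^ 2 / 2)) +
          (lam + (a : ℂ)) / (1 + (β : ℂ) ^ 2 / 2) / zLarge a β lam) := by
      rw [mul_add, ← hzs_eq, Ba, cpow_half_sq, cpow_half_sq]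
      linear_combination -zSmall_add_zLarge a β lam
    rw [hnum, hdenom, mul_div_mul_left _ _ hlam0]
    rfl
  have h := tendsto_boundarySymbol hβ hA hAB hb hx hy hr
  have hval : -((B : ℂ) ^ 2 - (A : ℂ) ^ 2) ^ 2 / (2 * β * A * (B - A)) =
      ((-a ^ 2 / (2 * β * A * (B - A)) : ℝ) : ℂ) := by
    rw [hBsq', add_sub_cancel_right]
    push_cast
    rfl
  rw [hval] at h
  refine h.congr' ?_
  filter_upwards [self_mem_nhdsWithin] with lam hlam0
  rw [calC, ← mul_assoc, mul_one_div_cancel hlam0, one_mul, calI1_add_calI2_div]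

theorem lam_calC_limit_at_zero
    (N : ℕ) (hN : 2 ≤ N) (a β ε₀ ε : ℝ)
    (ha : 0 < a) (hβ : β ≠ 0)
    (hε₀ : 0 < ε₀) (hε₀' : ε₀ < Real.pi / 2)
    (htan : |β| / Real.sqrt 2 ≤ Real.tan ε₀)
    (hε : ε₀ < ε) (hε' : ε < Real.pi / 2)
    (ξ' : EuclideanSpace ℝ (Fin (N - 1))) (hξ' : ξ' ≠ 0) :
    Filter.Tendsto (fun lam : ℂ => lam * calC a β lam ‖ξ'‖)
      (nhdsWithin 0 (SectorS ε))
      (nhds (((-a ^ 2 / (2 * β * ‖ξ'‖ * (Real.sqrt (a + ‖ξ'‖ ^ 2) - ‖ξ'‖))) : ℝ) : ℂ)) := by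
  exact (tendsto_lam_mul_calC ha hβ (norm_pos_iff.mpr hξ')).mono_left
    (nhdsWithin_mono 0 fun _ h => h.1)
end
end
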